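/- arXiv:1208.2342 — 6 statements merged into one kernel-verified Lean document; each statement's English description precedes it below -/
import Mathlib

section
/- Let x₁, …, x_N be N ≥ 1 pairwise distinct points of ℝⁿ and let α₀, α₁, …, α_N be nonnegative reals with ∑_{j=0}^N α_j = 1. Define v(x) := ∏_{j=1}^N |x−x_j|^{(2−n)α_j} and W(x) := (n−2)² [ ∑_{i=1}^N α₀α_i/|x−x_i|² + ∑_{1≤i<j≤N} α_iα_j |x_i−x_j|²/(|x−x_i|²|x−x_j|²) ]. Then −Δv(x) = W(x) v(x) for every x ∈ ℝⁿ \ {x₁,…,x_N}. -/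
open MeasureTheory Finset

noncomputable section

abbrev Euc (n : ℕ) := EuclideanSpace ℝ (Fin n)

/-- The `i`-th partial derivative of `u` at `x`. -/
def pd {n : ℕ} (i : Fin n) (u : Euc n → ℝ) (x : Euc n) : ℝ :=
  fderiv ℝ u x (EuclideanSpace.single i 1)

/-- The second partial derivative `∂ᵢ∂ⱼ u` at `x`. -/
def pd2 {n : ℕ} (i j : Fin n) (u : Euc n → ℝ) (x : Euc n) : ℝ :=
  fderiv ℝ (fun y => fderiv ℝ u y (EuclideanSpace.single j 1)) x
    (EuclideanSpace.single i 1)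

/-- The Euclidean Laplacian `Δu(x) = ∑ᵢ ∂ᵢ∂ᵢ u (x)`. -/
def lap {n : ℕ} (u : Euc n → ℝ) (x : Euc n) : ℝ := ∑ i, pd2 i i u x

theorem hasFDerivAt_norm_sub_sq {n : ℕ} (p y : Euc n) :
    HasFDerivAt (fun z : Euc n => ‖z - p‖ ^ 2) (2 • innerSL ℝ (y - p)) y := by
  simpa using ((hasFDerivAt_id (𝕜 := ℝ) y).sub_const p).norm_sq

/-- The product of powers of distances is the exponential of a sum of logarithms. -/
theorem prod_norm_sub_rpow_eq_exp {n N : ℕ} (pt : Fin N → Euc n) (c : Fin N → ℝ) {y : Euc n}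
    (hy : ∀ j, y ≠ pt j) :
    ∏ j, ‖y - pt j‖ ^ c j = Real.exp (∑ j, c j / 2 * Real.log (‖y - pt j‖ ^ 2)) := by
  rw [Real.exp_sum]
  refine Finset.prod_congr rfl fun j _ => ?_
  rw [Real.rpow_def_of_pos (norm_pos_iff.2 (sub_ne_zero.2 (hy j))), Real.log_pow]
  congr 1
  push_cast
  ring

theorem eventually_forall_ne {n N : ℕ} (pt : Fin N → Euc n) {x : Euc n} (hx : ∀ j, x ≠ pt j) :
    ∀ᶠ y in nhds x, ∀ j, y ≠ pt j :=
  Filter.eventually_all.2 fun j => eventually_ne_nhds (hx j)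

theorem norm_sub_sq_ne_zero {n : ℕ} {x p : Euc n} (h : x ≠ p) : ‖x - p‖ ^ 2 ≠ 0 :=
  pow_ne_zero 2 (norm_ne_zero_iff.2 (sub_ne_zero.2 h))

theorem hasFDerivAt_prod_norm_sub_rpow {n N : ℕ} (pt : Fin N → Euc n) (c : Fin N → ℝ)
    {y : Euc n} (hy : ∀ j, y ≠ pt j) :
    HasFDerivAt (fun z => ∏ j, ‖z - pt j‖ ^ c j)
      ((∏ j, ‖y - pt j‖ ^ c j) • ∑ j, (c j / ‖y - pt j‖ ^ 2) • innerSL ℝ (y - pt j)) y := by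
  have h := (HasFDerivAt.fun_sum (u := Finset.univ) fun j _ =>
    ((hasFDerivAt_norm_sub_sq (pt j) y).log (norm_sub_sq_ne_zero (hy j))).const_mul (c j / 2)).exp
  refine (h.congr_of_eventuallyEq ?_).congr_fderiv ?_
  · filter_upwards [eventually_forall_ne pt hy] with z hz
    exact prod_norm_sub_rpow_eq_exp pt c hz
  · rw [prod_norm_sub_rpow_eq_exp pt c hy]
    congr 1
    refine Finset.sum_congr rfl fun j _ => ?_
    ext z
    simp
    ring

theorem pd2_prod_norm_sub_rpow {n N : ℕ} (pt : Fin N → Euc n) (c : Fin N → ℝ)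
    {x : Euc n} (hx : ∀ j, x ≠ pt j) (k : Fin n) :
    pd2 k k (fun z => ∏ j, ‖z - pt j‖ ^ c j) x =
      (∏ j, ‖x - pt j‖ ^ c j) * ((∑ j, c j * (x - pt j) k / ‖x - pt j‖ ^ 2) ^ 2 +
        ∑ j, c j * (1 / ‖x - pt j‖ ^ 2 - 2 * (x - pt j) k ^ 2 / (‖x - pt j‖ ^ 2) ^ 2)) := by
  have hfd : (fun y => fderiv ℝ (fun z => ∏ j, ‖z - pt j‖ ^ c j) y (EuclideanSpace.single k 1))
      =ᶠ[nhds x] fun y => (∏ j, ‖y - pt j‖ ^ c j) *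
        ∑ j, c j * ((y - pt j) k * (‖y - pt j‖ ^ 2)⁻¹) := by
    filter_upwards [eventually_forall_ne pt hx] with y hy
    rw [(hasFDerivAt_prod_norm_sub_rpow pt c hy).fderiv]
    simp only [smul_apply, _root_.sum_apply, innerSL_apply_apply, smul_eq_mul,
      EuclideanSpace.inner_single_right]
    congr 1
    refine Finset.sum_congr rfl fun j _ => ?_
    simp
    ring
  have hcoord (j : Fin N) : HasFDerivAt (fun y : Euc n => (y - pt j) k)
      (EuclideanSpace.proj k : Euc n →L[ℝ] ℝ) x := by
    simpa using (EuclideanSpace.proj k : Euc n →L[ℝ] ℝ).hasFDerivAt.sub_const (pt j k)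
  have hinv (j : Fin N) := (hasDerivAt_inv (norm_sub_sq_ne_zero (hx j))).comp_hasFDerivAt x
    (hasFDerivAt_norm_sub_sq (pt j) x)
  have h : HasFDerivAt (fun y => (∏ j, ‖y - pt j‖ ^ c j) *
      ∑ j, c j * ((y - pt j) k * (‖y - pt j‖ ^ 2)⁻¹)) _ x :=
    (hasFDerivAt_prod_norm_sub_rpow pt c hx).mul
      (HasFDerivAt.fun_sum (u := Finset.univ) fun j _ =>
        ((hcoord j).mul (hinv j)).const_mul (c j))
  unfold pd2
  rw [hfd.fderiv_eq, h.fderiv]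
  simp only [add_apply, smul_apply, _root_.sum_apply, innerSL_apply_apply,
    smul_eq_mul, EuclideanSpace.inner_single_right]
  rw [add_comm, mul_add, mul_left_comm, pow_two (∑ j, _)]
  congr 1
  · congr 1
    congr 1 <;> refine Finset.sum_congr rfl fun j _ => ?_ <;> simp <;> ring
  · congr 1
    refine Finset.sum_congr rfl fun j _ => ?_
    congr 1
    simp
    ring

theorem lap_prod_norm_sub_rpow {n N : ℕ} (pt : Fin N → Euc n) (c : Fin N → ℝ)
    {x : Euc n} (hx : ∀ j, x ≠ pt j) :
    lap (fun z => ∏ j, ‖z - pt j‖ ^ c j) x =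
      (∏ j, ‖x - pt j‖ ^ c j) *
        ((∑ i, ∑ j, c i * c j * inner ℝ (x - pt i) (x - pt j) /
            (‖x - pt i‖ ^ 2 * ‖x - pt j‖ ^ 2)) +
          ∑ j, c j * ((n : ℝ) - 2) / ‖x - pt j‖ ^ 2) := by
  simp only [lap, pd2_prod_norm_sub_rpow pt c hx, ← Finset.mul_sum, Finset.sum_add_distrib]
  congr 2
  · simp only [pow_two (∑ j, _), Finset.sum_mul_sum]
    rw [Finset.sum_comm]
    refine Finset.sum_congr rfl fun i _ => ?_
    rw [Finset.sum_comm]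
    refine Finset.sum_congr rfl fun j _ => ?_
    simp only [PiLp.inner_apply, Finset.mul_sum, Finset.sum_div]
    refine Finset.sum_congr rfl fun k _ => ?_
    simp only [RCLike.inner_apply, conj_trivial]
    ring
  · rw [Finset.sum_comm]
    refine Finset.sum_congr rfl fun j _ => ?_
    have hr := norm_sub_sq_ne_zero (hx j)
    have hs : ∑ k, (x - pt j) k ^ 2 = ‖x - pt j‖ ^ 2 := by
      simp [EuclideanSpace.norm_sq_eq]
    rw [← Finset.mul_sum, Finset.sum_sub_distrib, ← Finset.sum_div, ← Finset.sum_div,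
      ← Finset.mul_sum, hs]
    simp only [Finset.sum_const, Finset.card_univ, Fintype.card_fin, nsmul_eq_mul]
    field_simp

theorem sum_sum_eq_two_mul_sum_lt {N : ℕ} (f : Fin N → Fin N → ℝ) (hsymm : ∀ i j, f i j = f j i)
    (hdiag : ∀ i, f i i = 0) :
    ∑ i, ∑ j, f i j = 2 * ∑ i, ∑ j ∈ Finset.univ.filter (fun j => i < j), f i j := by
  have hsplit (i j : Fin N) :
      f i j = (if i < j then f i j else 0) + if j < i then f j i else 0 := by
    rcases lt_trichotomy i j with h | rfl | h
    · simp [h, h.not_gt]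
    · simp [hdiag]
    · simp [h, h.not_gt, hsymm i j]
  simp only [Finset.sum_filter]
  rw [Finset.sum_congr rfl fun i _ => Finset.sum_congr rfl fun j _ => hsplit i j]
  simp only [Finset.sum_add_distrib]
  rw [Finset.sum_comm (f := fun i j => if j < i then f j i else 0), two_mul]

theorem stmt14 {n : ℕ} (hn : 3 ≤ n) (N : ℕ) (hN : 1 ≤ N)
    (pt : Fin N → Euc n) (hpt : Function.Injective pt)
    (α₀ : ℝ) (α : Fin N → ℝ) (hα₀ : 0 ≤ α₀) (hα : ∀ j, 0 ≤ α j)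
    (hsum : α₀ + ∑ j, α j = 1)
    (v W : Euc n → ℝ)
    (hv : ∀ x, v x = ∏ j, ‖x - pt j‖ ^ ((2 - (n : ℝ)) * α j))
    (hW : ∀ x, W x = ((n : ℝ) - 2) ^ 2 *
      ((∑ i, α₀ * α i / ‖x - pt i‖ ^ 2) +
        ∑ i, ∑ j ∈ Finset.univ.filter (fun j => i < j),
          α i * α j * ‖pt i - pt j‖ ^ 2 / (‖x - pt i‖ ^ 2 * ‖x - pt j‖ ^ 2))) :
    ∀ x : Euc n, (∀ i, x ≠ pt i) → -lap v x = W x * v x := by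
  intro x hx
  obtain rfl : v = fun x => ∏ j, ‖x - pt j‖ ^ ((2 - (n : ℝ)) * α j) := funext hv
  rw [lap_prod_norm_sub_rpow pt _ hx, hW, mul_comm _ (∏ j, _), ← mul_neg]
  congr 1
  set r : Fin N → ℝ := fun i => ‖x - pt i‖ ^ 2 with hr
  have hr0 (i : Fin N) : r i ≠ 0 := norm_sub_sq_ne_zero (hx i)
  have hinner (i j : Fin N) :
      inner ℝ (x - pt i) (x - pt j) = (r i + r j - ‖pt i - pt j‖ ^ 2) / 2 := by
    have h := norm_sub_sq_real (x - pt i) (x - pt j)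
    rw [sub_sub_sub_cancel_left, norm_sub_rev] at h
    simp only [hr]
    linarith
  have hpairs := sum_sum_eq_two_mul_sum_lt
    (fun i j => α i * α j * ‖pt i - pt j‖ ^ 2 / (r i * r j))
    (fun i j => by rw [norm_sub_rev, mul_comm (α i), mul_comm (r i)]) (fun i => by simp)
  have hterm (i j : Fin N) : (2 - (n : ℝ)) * α i * ((2 - (n : ℝ)) * α j) *
      inner ℝ (x - pt i) (x - pt j) / (r i * r j) = ((n : ℝ) - 2) ^ 2 / 2 *
        (α i / r i * α j + α i * (α j / r j) -
          α i * α j * ‖pt i - pt j‖ ^ 2 / (r i * r j)) := by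
    have hi := hr0 i
    have hj := hr0 j
    rw [hinner]
    field_simp
    ring
  have hone : ∑ j, α j = 1 - α₀ := by linarith
  have hlin : ∑ j, (2 - (n : ℝ)) * α j * ((n : ℝ) - 2) / r j =
      -((n : ℝ) - 2) ^ 2 * ∑ j, α j / r j := by
    rw [Finset.mul_sum]
    exact Finset.sum_congr rfl fun j _ => by ring
  have hzero : ∑ i, α₀ * α i / r i = α₀ * ∑ i, α i / r i := by
    rw [Finset.mul_sum]
    exact Finset.sum_congr rfl fun j _ => by ring
  simp only [← hr] at *
  change -((∑ i, ∑ j, _ / (r i * r j)) + ∑ j, _ / r j) = _ * ((∑ i, _ / r i) +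
    ∑ i, ∑ j ∈ _, _ / (r i * r j))
  rw [hlin, hzero]
  simp only [hterm, ← Finset.mul_sum, Finset.sum_sub_distrib, Finset.sum_add_distrib,
    ← Finset.sum_mul, hone, hpairs]
  ring
end
end

section
/- Let x₁, …, x_N be N ≥ 1 pairwise distinct points of ℝⁿ and let α₀, α₁, …, α_N be nonnegative reals with ∑_{j=0}^N α_j = 1. Define the multipolar Hardy weight W(x) := (n−2)² [ ∑_{i=1}^N α₀α_i/|x−x_i|² + ∑_{1≤i<j≤N} α_iα_j |x_i−x_j|²/(|x−x_i|²|x−x_j|²) ]. Then the multipolar Hardy inequality ∫ |∇φ(x)|² dx ≥ ∫ W(x) φ(x)² dx holds for every φ ∈ C_c^∞(ℝⁿ \ {x₁,…,x_N}). -/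
open MeasureTheory Finset

noncomputable section

/-- The radial integration by parts `∫ div (h(x) (x - p)) = 0` for compactly supported `C¹` `h`. -/
theorem integral_fderiv_sub_add_mul {n : ℕ} (p : Euc n) {h : Euc n → ℝ}
    (hh : ContDiff ℝ 1 h) (hc : HasCompactSupport h) :
    ∫ x, (fderiv ℝ h x (x - p) + n * h x) = 0 := by
  have hd : Differentiable ℝ h := hh.differentiable one_ne_zero
  have hcont : Continuous (fderiv ℝ h) := hh.continuous_fderiv one_ne_zero
  have hcoord : ∀ k : Fin n, ∫ x, (fderiv ℝ h x (EuclideanSpace.single k 1) * (x k - p k) + h x)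
      = 0 := by
    intro k
    let L : Euc n →L[ℝ] ℝ := EuclideanSpace.proj k
    have hg : ∀ x : Euc n, HasFDerivAt (fun x : Euc n => x k - p k) L x := fun x =>
      L.hasFDerivAt.sub_const (p k)
    have hgc : Continuous (fun x : Euc n => x k - p k) := by fun_prop
    have i1 : Integrable (fun x => fderiv ℝ h x (EuclideanSpace.single k 1) * (x k - p k)) :=
      Continuous.integrable_of_hasCompactSupport ((hcont.clm_apply continuous_const).mul hgc)
        ((hc.fderiv_apply ℝ _).mul_right)
    have i2 : Integrable h := hh.continuous.integrable_of_hasCompactSupport hc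
    have i3 : Integrable (fun x => h x * (x k - p k)) :=
      Continuous.integrable_of_hasCompactSupport (hh.continuous.mul hgc) hc.mul_right
    have hg' : ∀ x, fderiv ℝ (fun x : Euc n => x k - p k) x (EuclideanSpace.single k 1) = 1 := by
      intro x
      rw [(hg x).fderiv]
      simp [L]
    have key := integral_mul_fderiv_eq_neg_fderiv_mul_of_integrable (μ := volume)
      (f := h) (g := fun x : Euc n => x k - p k) (v := EuclideanSpace.single k 1)
      i1 (by simpa only [hg', mul_one] using i2) i3 (fun x _ => hd x) (fun x _ => (hg x).differentiableAt)
    simp only [hg', mul_one] at key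
    rw [integral_add i1 i2, key]
    ring
  have hsum : ∀ x, fderiv ℝ h x (x - p) + n * h x =
      ∑ k, (fderiv ℝ h x (EuclideanSpace.single k 1) * (x k - p k) + h x) := by
    intro x
    rw [Finset.sum_add_distrib]
    congr 1
    · conv_lhs => rw [← (EuclideanSpace.basisFun (Fin n) ℝ).sum_repr (x - p)]
      simp [map_sum, mul_comm]
    · simp
  simp_rw [hsum]
  rw [integral_finsetSum]
  · exact Finset.sum_eq_zero fun k _ => hcoord k
  · intro k _
    apply Continuous.integrable_of_hasCompactSupport
    · have := hcont.clm_apply (continuous_const (y := EuclideanSpace.single k (1 : ℝ)))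
      have := hh.continuous
      fun_prop
    · exact ((hc.fderiv_apply ℝ _).mul_right).add hc

/-- Dividing by a squared distance preserves smoothness away from the pole. -/
theorem contDiff_sq_div_norm_sub_sq {n : ℕ} {φ : Euc n → ℝ} {p : Euc n} {m : WithTop ℕ∞}
    (hφ : ContDiff ℝ m φ) (hp : p ∉ tsupport φ) :
    ContDiff ℝ m (fun x => φ x ^ 2 / ‖x - p‖ ^ 2) := by
  rw [contDiff_iff_contDiffAt]
  intro x
  by_cases hx : x = p
  · subst hx
    have := notMem_tsupport_iff_eventuallyEq.1 hp
    refine (contDiffAt_const (c := (0 : ℝ))).congr_of_eventuallyEq ?_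
    filter_upwards [this] with y hy
    simp [hy]
  · have h0 : ‖x - p‖ ^ 2 ≠ 0 := pow_ne_zero _ (norm_ne_zero_iff.2 (sub_ne_zero.2 hx))
    exact (hφ.contDiffAt.pow 2).div ((contDiffAt_id.sub contDiffAt_const).norm_sq ℝ) h0

/-- The radial derivative of `φ² / |x - p|²` away from the pole. -/
theorem fderiv_sq_div_norm_sub_sq {n : ℕ} {φ : Euc n → ℝ} {p x : Euc n}
    (hφ : DifferentiableAt ℝ φ x) (hx : x ≠ p) :
    fderiv ℝ (fun x => φ x ^ 2 / ‖x - p‖ ^ 2) x (x - p) =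
      2 * φ x * fderiv ℝ φ x (x - p) / ‖x - p‖ ^ 2 - 2 * (φ x ^ 2 / ‖x - p‖ ^ 2) := by
  have h0 : ‖x - p‖ ≠ 0 := norm_ne_zero_iff.2 (sub_ne_zero.2 hx)
  have h1 : HasFDerivAt (fun x => ‖x - p‖ ^ 2) _ x := ((hasFDerivAt_id x).sub_const p).norm_sq
  have h2 : HasFDerivAt (fun x => φ x ^ 2 * (‖x - p‖ ^ 2)⁻¹) _ x :=
    (hφ.hasFDerivAt.pow 2).mul ((hasDerivAt_inv (pow_ne_zero 2 h0)).comp_hasFDerivAt x h1)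
  simp_rw [div_eq_mul_inv]
  rw [h2.fderiv]
  simp [-map_sub, inner_self_eq_norm_sq_to_K]
  field_simp
  ring

/-- Splitting a symmetric double sum into its diagonal and twice its strictly upper part. -/
theorem sum_sum_eq_diag_add_two_mul_lt {N : ℕ} (f : Fin N → Fin N → ℝ)
    (hf : ∀ i j, f i j = f j i) :
    ∑ i, ∑ j, f i j = ∑ i, f i i + 2 * ∑ i, ∑ j ∈ Finset.univ.filter (fun j => i < j), f i j := by
  have hswap : ∑ i, ∑ j ∈ Finset.univ.filter (fun j => i < j), f i j =
      ∑ i, ∑ j, if j < i then f i j else 0 := by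
    simp_rw [Finset.sum_filter]
    rw [Finset.sum_comm]
    simp_rw [hf]
  have hsplit : ∀ i j, f i j = (if i = j then f i j else 0) + (if i < j then f i j else 0) +
      (if j < i then f i j else 0) := by
    intro i j
    rcases lt_trichotomy i j with h | h | h
    · simp [h, h.ne, h.not_gt]
    · simp [h]
    · simp [h, h.ne', h.not_gt]
  calc ∑ i, ∑ j, f i j = ∑ i, ∑ j, ((if i = j then f i j else 0) + (if i < j then f i j else 0) +
      (if j < i then f i j else 0)) := by simp_rw [← hsplit]
    _ = _ := by
      simp_rw [Finset.sum_add_distrib]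
      rw [← hswap]
      simp [Finset.sum_filter]
      ring

/-- The squared length of a weighted sum of inversions `(x - xᵢ) / |x - xᵢ|²`. -/
theorem norm_sum_smul_inversion_sq {n N : ℕ} (pt : Fin N → Euc n) (α : Fin N → ℝ) (x : Euc n)
    (hx : ∀ i, x ≠ pt i) :
    ‖∑ i, (α i / ‖x - pt i‖ ^ 2) • (x - pt i)‖ ^ 2 =
      (∑ j, α j) * (∑ i, α i / ‖x - pt i‖ ^ 2) -
        ∑ i, ∑ j ∈ Finset.univ.filter (fun j => i < j),
          α i * α j * ‖pt i - pt j‖ ^ 2 / (‖x - pt i‖ ^ 2 * ‖x - pt j‖ ^ 2) := by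
  have hpos : ∀ i, ‖x - pt i‖ ≠ 0 := fun i => norm_ne_zero_iff.2 (sub_ne_zero.2 (hx i))
  have hterm : ∀ i j, inner ℝ ((α i / ‖x - pt i‖ ^ 2) • (x - pt i))
      ((α j / ‖x - pt j‖ ^ 2) • (x - pt j)) =
      α i * (α j / ‖x - pt j‖ ^ 2) / 2 + α j * (α i / ‖x - pt i‖ ^ 2) / 2 -
      (α i * α j * ‖pt i - pt j‖ ^ 2 / (‖x - pt i‖ ^ 2 * ‖x - pt j‖ ^ 2)) / 2 := by
    intro i j
    have h : ‖pt i - pt j‖ ^ 2 = ‖x - pt j‖ ^ 2 - 2 * inner ℝ (x - pt j) (x - pt i) +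
        ‖x - pt i‖ ^ 2 := by
      rw [← norm_sub_sq_real]
      congr 2
      abel
    rw [h, real_inner_smul_left, real_inner_smul_right, real_inner_comm]
    have := hpos i
    have := hpos j
    field_simp
    ring
  rw [← real_inner_self_eq_norm_sq, sum_inner]
  simp_rw [inner_sum, hterm, Finset.sum_sub_distrib, Finset.sum_add_distrib, ← Finset.sum_div]
  rw [sum_sum_eq_diag_add_two_mul_lt (fun i j =>
    α i * α j * ‖pt i - pt j‖ ^ 2 / (‖x - pt i‖ ^ 2 * ‖x - pt j‖ ^ 2))
    (fun i j => by rw [norm_sub_rev (pt i)]; ring)]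
  rw [Finset.sum_comm (f := fun i j => α j * (α i / ‖x - pt i‖ ^ 2))]
  simp_rw [← Finset.mul_sum, ← Finset.sum_mul]
  simp

theorem stmt15 {n : ℕ} (hn : 3 ≤ n) (N : ℕ) (hN : 1 ≤ N)
    (pt : Fin N → Euc n) (hpt : Function.Injective pt)
    (α₀ : ℝ) (α : Fin N → ℝ) (hα₀ : 0 ≤ α₀) (hα : ∀ j, 0 ≤ α j)
    (hsum : α₀ + ∑ j, α j = 1)
    (W : Euc n → ℝ)
    (hW : ∀ x, W x = ((n : ℝ) - 2) ^ 2 *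
      ((∑ i, α₀ * α i / ‖x - pt i‖ ^ 2) +
        ∑ i, ∑ j ∈ Finset.univ.filter (fun j => i < j),
          α i * α j * ‖pt i - pt j‖ ^ 2 / (‖x - pt i‖ ^ 2 * ‖x - pt j‖ ^ 2))) :
    ∀ φ : Euc n → ℝ, ContDiff ℝ (⊤ : ℕ∞) φ → HasCompactSupport φ →
      tsupport φ ⊆ {x : Euc n | ∀ i, x ≠ pt i} →
      ∫ x in {x : Euc n | ∀ i, x ≠ pt i}, W x * φ x ^ 2 ≤
        ∫ x in {x : Euc n | ∀ i, x ≠ pt i}, ‖gradient φ x‖ ^ 2 := by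
  intro φ hφ hc hsupp
  have hφ1 : ContDiff ℝ 1 φ := hφ.of_le (by exact_mod_cast le_top)
  have hdφ : Differentiable ℝ φ := hφ1.differentiable one_ne_zero
  have : NeZero n := ⟨by omega⟩
  have hae : ∀ᵐ x : Euc n, x ∈ {x : Euc n | ∀ i, x ≠ pt i} := by
    simp only [Set.mem_ofPred_eq]
    exact ae_all_iff.2 fun i => Measure.ae_ne volume (pt i)
  rw [Measure.restrict_eq_self_of_ae_mem hae]
  set h : Fin N → Euc n → ℝ := fun i x => φ x ^ 2 / ‖x - pt i‖ ^ 2 with hh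
  have hhC : ∀ i, ContDiff ℝ 1 (h i) := fun i =>
    contDiff_sq_div_norm_sub_sq hφ1 fun hp => hsupp hp i rfl
  have hhS : ∀ i, HasCompactSupport (h i) := fun i =>
    hc.mono fun x hx => by
      simp only [hh, Function.mem_support] at hx ⊢
      rintro h0
      simp [h0] at hx
  set K : Fin N → Euc n → ℝ := fun i x => fderiv ℝ (h i) x (x - pt i) + n * h i x with hK
  have hKint : ∀ i, Integrable (K i) := by
    intro i
    apply Continuous.integrable_of_hasCompactSupport
    · have h1 := ((hhC i).continuous_fderiv one_ne_zero).clm_apply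
        (continuous_id.sub (continuous_const (y := pt i)))
      exact h1.add (continuous_const.mul (hhC i).continuous)
    · refine HasCompactSupport.add ?_ (hhS i).mul_left
      refine ((hhS i).fderiv ℝ).mono fun x hx => ?_
      simp only [Function.mem_support] at hx ⊢
      rintro h0
      simp [h0] at hx
  have hGint : Integrable (fun x => ‖gradient φ x‖ ^ 2) := by
    have hg : ∀ x, ‖gradient φ x‖ = ‖fderiv ℝ φ x‖ := fun x => by simp [gradient]
    simp_rw [hg]
    apply Continuous.integrable_of_hasCompactSupport
    · exact (hφ1.continuous_fderiv one_ne_zero).norm.pow 2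
    · refine (hc.fderiv ℝ).mono fun x hx => ?_
      simp only [Function.mem_support] at hx ⊢
      rintro h0
      simp [h0] at hx
  have hSint : Integrable (fun x => ((n : ℝ) - 2) * ∑ i, α i * K i x) :=
    (integrable_finsetSum _ fun i _ => (hKint i).const_mul _).const_mul _
  have hzero : ∫ x, ((n : ℝ) - 2) * ∑ i, α i * K i x = 0 := by
    rw [integral_const_mul, integral_finsetSum _ fun i _ => (hKint i).const_mul _]
    simp_rw [integral_const_mul]
    have hK0 : ∀ i, ∫ x, K i x = 0 := fun i => integral_fderiv_sub_add_mul _ (hhC i) (hhS i)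
    simp [hK0]
  have hW0 : ∀ x, 0 ≤ W x * φ x ^ 2 := by
    intro x
    rw [hW]
    refine mul_nonneg (mul_nonneg (sq_nonneg _) (add_nonneg ?_ ?_)) (sq_nonneg _)
    · exact Finset.sum_nonneg fun i _ => div_nonneg (mul_nonneg hα₀ (hα i)) (sq_nonneg _)
    · exact Finset.sum_nonneg fun i _ => Finset.sum_nonneg fun j _ =>
        div_nonneg (mul_nonneg (mul_nonneg (hα i) (hα j)) (sq_nonneg _)) (by positivity)
  calc ∫ x, W x * φ x ^ 2
      ≤ ∫ x, (‖gradient φ x‖ ^ 2 + ((n : ℝ) - 2) * ∑ i, α i * K i x) := by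
        refine integral_mono_of_nonneg (.of_forall hW0) (hGint.add hSint) ?_
        filter_upwards [hae] with x hx
        set V : Euc n := ∑ i, (α i / ‖x - pt i‖ ^ 2) • (x - pt i) with hV
        have hKx : ∑ i, α i * K i x =
            2 * φ x * inner ℝ (gradient φ x) V +
              ((n : ℝ) - 2) * φ x ^ 2 * ∑ i, α i / ‖x - pt i‖ ^ 2 := by
          rw [hV, inner_sum, Finset.mul_sum, Finset.mul_sum, ← Finset.sum_add_distrib]
          refine Finset.sum_congr rfl fun i _ => ?_
          have hgi : inner ℝ (gradient φ x) (x - pt i) = fderiv ℝ φ x (x - pt i) := by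
            simp only [gradient, InnerProductSpace.toDual_symm_apply]
          simp only [hK, hh]
          rw [fderiv_sq_div_norm_sub_sq (hdφ x) (hx i), real_inner_smul_right, hgi]
          ring
        have hsq : 0 ≤ ‖gradient φ x + (((n : ℝ) - 2) * φ x) • V‖ ^ 2 := sq_nonneg _
        rw [norm_add_sq_real, real_inner_smul_right, norm_smul, mul_pow, Real.norm_eq_abs, sq_abs,
          hV, norm_sum_smul_inversion_sq pt α x hx, ← hV,
          show ∑ j, α j = 1 - α₀ by linarith] at hsq
        have hα₀sum : ∑ i, α₀ * α i / ‖x - pt i‖ ^ 2 = α₀ * ∑ i, α i / ‖x - pt i‖ ^ 2 := by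
          rw [Finset.mul_sum]
          exact Finset.sum_congr rfl fun i _ => mul_div_assoc _ _ _
        rw [hW, hKx, hα₀sum]
        linarith
    _ = ∫ x, ‖gradient φ x‖ ^ 2 := by
        rw [integral_add hGint hSint, hzero, add_zero]
end
end

section
/- Let B* := {x ∈ ℝ² : 0 < |x| < 1} be the punctured open unit disc in the plane. Then the Leray inequality ∫_{B*} |∇φ(x)|² dx ≥ (1/4) ∫_{B*} φ(x)²/(|x| log|x|)² dx holds for every φ ∈ C_c^∞(B*). -/
open MeasureTheory

noncomputable section

abbrev Euc2 := EuclideanSpace ℝ (Fin 2)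

theorem integral_fderiv_apply_self {ι : Type*} [Fintype ι] {ψ : EuclideanSpace ℝ ι → ℝ}
    (hψ : ContDiff ℝ 1 ψ) (hcs : HasCompactSupport ψ) :
    ∫ x, fderiv ℝ ψ x x = -(Fintype.card ι * ∫ x, ψ x) := by
  classical
  have hc (v : EuclideanSpace ℝ ι) : Continuous fun x ↦ fderiv ℝ ψ x v :=
    (hψ.continuous_fderiv one_ne_zero).clm_apply continuous_const
  have hint (i : ι) :
      Integrable fun x : EuclideanSpace ℝ ι ↦
        fderiv ℝ ψ x (EuclideanSpace.single i 1) * x i :=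
    ((hc _).mul (by fun_prop)).integrable_of_hasCompactSupport
      ((hcs.fderiv_apply ℝ _).mul_right)
  have hψint : Integrable ψ := hψ.continuous.integrable_of_hasCompactSupport hcs
  have hcoord (i : ι) (x : EuclideanSpace ℝ ι) :
      fderiv ℝ (fun y : EuclideanSpace ℝ ι ↦ y i) x (EuclideanSpace.single i 1) = 1 := by
    rw [show (fun y : EuclideanSpace ℝ ι ↦ y i) = EuclideanSpace.proj (𝕜 := ℝ) i from rfl,
      ContinuousLinearMap.fderiv]
    simp
  have hparts (i : ι) :
      ∫ x : EuclideanSpace ℝ ι, fderiv ℝ ψ x (EuclideanSpace.single i 1) * x i =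
        -∫ x, ψ x := by
    have h := integral_mul_fderiv_eq_neg_fderiv_mul_of_integrable (μ := volume) (𝕜 := ℝ)
      (f := ψ) (g := fun y : EuclideanSpace ℝ ι ↦ y i) (v := EuclideanSpace.single i 1)
      (hint i) (by simpa [hcoord] using hψint)
      ((hψ.continuous.mul (by fun_prop)).integrable_of_hasCompactSupport hcs.mul_right)
      (fun x _ ↦ hψ.differentiable one_ne_zero x) (fun x _ ↦ by fun_prop)
    simp only [hcoord, mul_one] at h
    rw [h, neg_neg]
  have hsum (x : EuclideanSpace ℝ ι) :
      fderiv ℝ ψ x x = ∑ i, fderiv ℝ ψ x (EuclideanSpace.single i 1) * x i := by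
    have hx : x = ∑ i, x i • EuclideanSpace.single i (1 : ℝ) := by
      ext j; simp [Finset.sum_apply, Pi.single_apply]
    conv_lhs => rw [hx, map_sum]
    simp [← hx, mul_comm]
  simp_rw [hsum]
  rw [integral_finsetSum _ fun i _ ↦ hint i]
  simp [hparts]

theorem contDiff_mul_of_tsupport_subset {E : Type*} [NormedAddCommGroup E] [NormedSpace ℝ E]
    {n : WithTop ℕ∞} {f g : E → ℝ} (hf : ContDiff ℝ n f)
    (hg : ∀ x ∈ tsupport f, ContDiffAt ℝ n g x) : ContDiff ℝ n fun x ↦ f x * g x := by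
  refine contDiff_iff_contDiffAt.2 fun x ↦ ?_
  by_cases hx : x ∈ tsupport f
  · exact hf.contDiffAt.mul (hg x hx)
  · refine (contDiffAt_const (c := 0)).congr_of_eventuallyEq ?_
    filter_upwards [notMem_tsupport_iff_eventuallyEq.1 hx] with y hy
    simp [hy]

theorem hasDerivAt_inv_sq_mul_log {r : ℝ} (hr : r ≠ 0) (hlog : Real.log r ≠ 0) :
    HasDerivAt (fun s ↦ (s ^ 2 * Real.log s)⁻¹)
      (-(2 * r * Real.log r + r) / (r ^ 2 * Real.log r) ^ 2) r := by
  have h := (((hasDerivAt_pow 2 r).mul (Real.hasDerivAt_log hr)).inv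
    (mul_ne_zero (pow_ne_zero 2 hr) hlog))
  convert! h using 1
  simp only [Pi.mul_apply]
  field_simp
  norm_num
  ring

theorem stmt16
    (φ : Euc2 → ℝ) (hφ : ContDiff ℝ (⊤ : ℕ∞) φ) (hcs : HasCompactSupport φ)
    (hsupp : tsupport φ ⊆ {x : Euc2 | 0 < ‖x‖ ∧ ‖x‖ < 1}) :
    (1 / 4 : ℝ) * ∫ x in {x : Euc2 | 0 < ‖x‖ ∧ ‖x‖ < 1},
        φ x ^ 2 / (‖x‖ * Real.log ‖x‖) ^ 2
      ≤ ∫ x in {x : Euc2 | 0 < ‖x‖ ∧ ‖x‖ < 1}, ‖gradient φ x‖ ^ 2 := by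
  have hφ1 : ContDiff ℝ 1 φ := hφ.of_le (by exact_mod_cast le_top)
  have hφd : Differentiable ℝ φ := hφ1.differentiable one_ne_zero
  have hzero (x : Euc2) (hx : x ∉ {x : Euc2 | 0 < ‖x‖ ∧ ‖x‖ < 1}) : φ x = 0 :=
    image_eq_zero_of_notMem_tsupport fun h ↦ hx (hsupp h)
  have hnorm (x : Euc2) : ‖gradient φ x‖ = ‖fderiv ℝ φ x‖ := by
    rw [← toDual_gradient, LinearIsometryEquiv.norm_map]
  have hgzero (x : Euc2) (hx : x ∉ {x : Euc2 | 0 < ‖x‖ ∧ ‖x‖ < 1}) : gradient φ x = 0 := by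
    rw [← norm_eq_zero, hnorm, image_eq_zero_of_notMem_tsupport (f := fderiv ℝ φ)
      fun h ↦ hx (hsupp (tsupport_fderiv_subset ℝ h)), norm_zero]
  have hlog {x : Euc2} (hx : x ∈ {x : Euc2 | 0 < ‖x‖ ∧ ‖x‖ < 1}) : Real.log ‖x‖ ≠ 0 :=
    (Real.log_neg hx.1 hx.2).ne
  have hts : tsupport (fun x ↦ φ x ^ 2) ⊆ {x : Euc2 | 0 < ‖x‖ ∧ ‖x‖ < 1} := by
    refine (closure_mono fun x hx ↦ ?_).trans hsupp
    exact fun h ↦ hx (by simp [h])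
  have hcs2 : HasCompactSupport fun x ↦ φ x ^ 2 :=
    hcs.comp_left (g := fun t : ℝ ↦ t ^ 2) (by simp)
  have hN {x : Euc2} (hx : x ∈ {x : Euc2 | 0 < ‖x‖ ∧ ‖x‖ < 1}) : ContDiffAt ℝ 1 norm x :=
    contDiffAt_norm ℝ (norm_pos_iff.1 hx.1)
  have hlogN {x : Euc2} (hx : x ∈ {x : Euc2 | 0 < ‖x‖ ∧ ‖x‖ < 1}) :
      ContDiffAt ℝ 1 (fun y : Euc2 ↦ Real.log ‖y‖) x := (hN hx).log hx.1.ne'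
  set h : Euc2 → ℝ := fun x ↦ (‖x‖ ^ 2 * Real.log ‖x‖)⁻¹ with hh
  set ψ : Euc2 → ℝ := fun x ↦ φ x ^ 2 * h x with hψ_def
  have hψ : ContDiff ℝ 1 ψ := contDiff_mul_of_tsupport_subset (hφ1.pow 2) fun x hx ↦
    (((hN (hts hx)).pow 2).mul (hlogN (hts hx))).inv
      (mul_ne_zero (pow_ne_zero 2 (hts hx).1.ne') (hlog (hts hx)))
  have hψcs : HasCompactSupport ψ := hcs2.mul_right
  have hψint : Integrable ψ := hψ.continuous.integrable_of_hasCompactSupport hψcs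
  have hψ'int : Integrable fun x ↦ fderiv ℝ ψ x x :=
    ((hψ.continuous_fderiv one_ne_zero).clm_apply continuous_id).integrable_of_hasCompactSupport
      ((hψcs.fderiv ℝ).mono fun x hx hx' ↦ hx (by simp [hx']))
  have hdiv : ∫ x, (fderiv ℝ ψ x x + 2 * ψ x) = 0 := by
    rw [integral_add hψ'int (hψint.const_mul 2), integral_const_mul,
      integral_fderiv_apply_self hψ hψcs]
    simp
  have hWint : Integrable fun x ↦ φ x ^ 2 / (‖x‖ * Real.log ‖x‖) ^ 2 := by
    have hW : ContDiff ℝ 1 fun x ↦ φ x ^ 2 * ((‖x‖ * Real.log ‖x‖) ^ 2)⁻¹ :=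
      contDiff_mul_of_tsupport_subset (hφ1.pow 2) fun x hx ↦
        (((hN (hts hx)).mul (hlogN (hts hx))).pow 2).inv
          (pow_ne_zero 2 (mul_ne_zero (hts hx).1.ne' (hlog (hts hx))))
    simp only [div_eq_mul_inv]
    exact hW.continuous.integrable_of_hasCompactSupport hcs2.mul_right
  have hGint : Integrable fun x ↦ ‖gradient φ x‖ ^ 2 := by
    simp only [hnorm]
    have hG : HasCompactSupport fun x ↦ ‖fderiv ℝ φ x‖ ^ 2 :=
      (hcs.fderiv ℝ).comp_left (g := fun L : Euc2 →L[ℝ] ℝ ↦ ‖L‖ ^ 2) (by simp)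
    exact ((hφ1.continuous_fderiv one_ne_zero).norm.pow 2).integrable_of_hasCompactSupport hG
  have hψ' {x : Euc2} (hx : x ∈ {x : Euc2 | 0 < ‖x‖ ∧ ‖x‖ < 1}) :
      fderiv ℝ ψ x x + 2 * ψ x =
        2 * φ x * h x * inner ℝ (gradient φ x) x - φ x ^ 2 / (‖x‖ * Real.log ‖x‖) ^ 2 := by
    have hr : ‖x‖ ≠ 0 := hx.1.ne'
    have hl := hlog hx
    have hNd := (hN hx).differentiableAt one_ne_zero
    have hhd : HasFDerivAt h _ x :=
      (hasDerivAt_inv_sq_mul_log hr hl).comp_hasFDerivAt x hNd.hasFDerivAt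
    have hψd : HasFDerivAt ψ _ x := ((hφd x).hasFDerivAt.pow 2).mul hhd
    rw [hψd.fderiv, inner_gradient_left]
    simp [hNd.fderiv_norm_self, hψ_def, hh]
    field_simp
    ring
  have hpt (x : Euc2) : 1 / 2 * (fderiv ℝ ψ x x + 2 * ψ x) ≤
      ‖gradient φ x‖ ^ 2 - 1 / 4 * (φ x ^ 2 / (‖x‖ * Real.log ‖x‖) ^ 2) := by
    by_cases hx : x ∈ {x : Euc2 | 0 < ‖x‖ ∧ ‖x‖ < 1}
    · rw [hψ' hx]
      have hsq := sq_nonneg ‖gradient φ x - (φ x * h x / 2) • x‖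
      rw [norm_sub_sq_real, inner_smul_right, norm_smul, mul_pow, Real.norm_eq_abs, sq_abs] at hsq
      have hW : (φ x * h x / 2) ^ 2 * ‖x‖ ^ 2 =
          1 / 4 * (φ x ^ 2 / (‖x‖ * Real.log ‖x‖) ^ 2) := by
        have hr : ‖x‖ ≠ 0 := hx.1.ne'
        have hl := hlog hx
        simp only [hh]
        field_simp
        norm_num
      linarith
    · have hψz : fderiv ℝ ψ x = 0 := image_eq_zero_of_notMem_tsupport fun hx' ↦
        hx (hts (tsupport_mul_subset_left (tsupport_fderiv_subset ℝ hx')))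
      have hψx : ψ x = 0 := by simp [hψ_def, hzero x hx]
      simp [hψz, hψx, hgzero x hx, hzero x hx]
  have hmono := integral_mono ((hψ'int.add (hψint.const_mul 2)).const_mul (1 / 2))
    (hGint.sub (hWint.const_mul (1 / 4))) hpt
  simp only [Pi.add_apply, Pi.sub_apply] at hmono
  rw [integral_const_mul, hdiv, integral_sub hGint (hWint.const_mul _), integral_const_mul] at hmono
  rw [setIntegral_eq_integral_of_forall_compl_eq_zero fun x hx ↦ by simp [hzero x hx],
    setIntegral_eq_integral_of_forall_compl_eq_zero fun x hx ↦ by simp [hgzero x hx]]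
  linarith
end
end

section
/- Let B* := {x ∈ ℝⁿ : 0 < |x| < 1} be the punctured open unit ball. Then the inequality ∫_{B*} |∇φ(x)|² dx ≥ ((n−2)/2)² ∫_{B*} φ(x)²/(|x|(1−|x|^{n−2}))² dx holds for every φ ∈ C_c^∞(B*). -/
open MeasureTheory

noncomputable section

/-- The integral form of Euler's identity: `∫ x · ∇f = -n ∫ f` for compactly supported `f`. -/
lemma integral_fderiv_apply_self_s17 {n : ℕ} {f : Euc n → ℝ} (hf : ContDiff ℝ 1 f)
    (hc : HasCompactSupport f) :
    Integrable (fun x ↦ fderiv ℝ f x x) ∧ ∫ x, fderiv ℝ f x x = -(n * ∫ x, f x) := by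
  let e : Fin n → Euc n := fun i ↦ EuclideanSpace.single i 1
  have hdf : Continuous (fderiv ℝ f) := hf.continuous_fderiv one_ne_zero
  have hcdf : HasCompactSupport (fderiv ℝ f) := hc.fderiv ℝ
  have hint (i : Fin n) : Integrable (fun x ↦ fderiv ℝ f x (e i) * x i) := by
    refine Continuous.integrable_of_hasCompactSupport (by fun_prop) (hcdf.mono fun x hx h ↦ hx ?_)
    simp [h]
  have hexp (x : Euc n) : fderiv ℝ f x x = ∑ i, fderiv ℝ f x (e i) * x i := by
    have hx : x = ∑ i, x i • e i := by
      simpa [e] using ((EuclideanSpace.basisFun (Fin n) ℝ).sum_repr x).symm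
    conv_lhs => rw [hx, map_sum]
    rw [← hx]
    simp [mul_comm]
  have hcoord (i : Fin n) : ∫ x, fderiv ℝ f x (e i) * x i = -∫ x, f x := by
    have hd (x : Euc n) : fderiv ℝ (fun y : Euc n ↦ y i) x (e i) = 1 := by
      have : HasFDerivAt (fun y : Euc n ↦ y i) (EuclideanSpace.proj (𝕜 := ℝ) i) x :=
        (EuclideanSpace.proj (𝕜 := ℝ) i).hasFDerivAt
      simp [this.fderiv, e]
    have h := integral_mul_fderiv_eq_neg_fderiv_mul_of_integrable (μ := volume) (f := f)
      (g := fun y : Euc n ↦ y i) (v := e i) (hint i)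
      (by simpa [hd] using hf.continuous.integrable_of_hasCompactSupport hc)
      (Continuous.integrable_of_hasCompactSupport (by fun_prop) hc.mul_right)
      (fun x _ ↦ hf.differentiable one_ne_zero x) (fun x _ ↦ by fun_prop)
    simp only [hd, mul_one] at h
    rw [h, neg_neg]
  simp only [hexp]
  refine ⟨integrable_finsetSum _ fun i _ ↦ hint i, ?_⟩
  rw [integral_finsetSum _ fun i _ ↦ hint i]
  simp [hcoord]

lemma tsupport_sq_div_subset {X : Type*} [TopologicalSpace X] (φ D : X → ℝ) :
    tsupport (fun x ↦ φ x ^ 2 / D x) ⊆ tsupport φ :=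
  closure_mono fun x hx h ↦ hx (by simp [h])

lemma contDiff_sq_div_of_tsupport {E : Type*} [NormedAddCommGroup E] [NormedSpace ℝ E]
    {φ D : E → ℝ} (hφ : ContDiff ℝ 1 φ) (hD : ∀ x ∈ tsupport φ, ContDiffAt ℝ 1 D x)
    (h0 : ∀ x ∈ tsupport φ, D x ≠ 0) : ContDiff ℝ 1 fun x ↦ φ x ^ 2 / D x := by
  refine contDiff_iff_contDiffAt.mpr fun x ↦ ?_
  by_cases hx : x ∈ tsupport φ
  · exact (hφ.contDiffAt.pow 2).div (hD x hx) (h0 x hx)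
  · exact contDiffAt_const.congr_of_eventuallyEq
      (notMem_tsupport_iff_eventuallyEq.mp fun h ↦ hx (tsupport_sq_div_subset φ D h))

/-- The radial derivative of `φ² / (r² - r^(m+2))`. -/
lemma fderiv_sq_div_norm_apply_self {E : Type*} [NormedAddCommGroup E] [InnerProductSpace ℝ E]
    (m : ℕ) {φ : E → ℝ} {x : E} (hφ : DifferentiableAt ℝ φ x) (hx : 0 < ‖x‖)
    (h1 : 1 - ‖x‖ ^ m ≠ 0) :
    fderiv ℝ (fun y ↦ φ y ^ 2 / (‖y‖ ^ 2 - ‖y‖ ^ (m + 2))) x x =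
      2 * φ x * fderiv ℝ φ x x / (‖x‖ ^ 2 * (1 - ‖x‖ ^ m))
        + m * (φ x ^ 2 / (‖x‖ * (1 - ‖x‖ ^ m)) ^ 2)
        - (m + 2) * (φ x ^ 2 / (‖x‖ ^ 2 - ‖x‖ ^ (m + 2))) := by
  have hN : DifferentiableAt ℝ (fun y : E ↦ ‖y‖) x :=
    (contDiffAt_norm ℝ (n := 1) (norm_pos_iff.mp hx)).differentiableAt one_ne_zero
  have hNx : fderiv ℝ (fun y : E ↦ ‖y‖) x x = ‖x‖ := hN.fderiv_norm_self
  have hD : ‖x‖ ^ 2 - ‖x‖ ^ (m + 2) = ‖x‖ ^ 2 * (1 - ‖x‖ ^ m) := by ring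
  have hD0 : ‖x‖ ^ 2 - ‖x‖ ^ (m + 2) ≠ 0 := by
    rw [hD]; exact mul_ne_zero (by positivity) h1
  have h := (hφ.hasFDerivAt.pow 2).fun_mul ((hasDerivAt_inv hD0).comp_hasFDerivAt x
    ((hN.hasFDerivAt.pow 2).fun_sub (hN.hasFDerivAt.pow (m + 2))))
  simp only [Function.comp_def, ← div_eq_mul_inv] at h
  rw [h.fderiv]
  simp [hNx, hD]
  field_simp
  ring

lemma hardy_pointwise {E : Type*} [NormedAddCommGroup E] [InnerProductSpace ℝ E]
    (g x : E) (a p d : ℝ) (hx : 0 < ‖x‖) (hd : d ≠ 0) :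
    a ^ 2 * (p ^ 2 / (‖x‖ * d) ^ 2) ≤ ‖g‖ ^ 2
      + a * (2 * p * inner ℝ g x / (‖x‖ ^ 2 * d) + 2 * a * (p ^ 2 / (‖x‖ * d) ^ 2)) := by
  have h := sq_nonneg ‖g + (a * p / (‖x‖ ^ 2 * d)) • x‖
  rw [norm_add_sq_real, inner_smul_right, norm_smul, mul_pow, Real.norm_eq_abs, sq_abs] at h
  have h2 : (a * p / (‖x‖ ^ 2 * d)) ^ 2 * ‖x‖ ^ 2 = a ^ 2 * (p ^ 2 / (‖x‖ * d) ^ 2) := by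
    field_simp
  rw [h2] at h
  have h3 : 2 * (a * p / (‖x‖ ^ 2 * d) * inner ℝ g x)
      = a * (2 * p * inner ℝ g x / (‖x‖ ^ 2 * d)) := by ring
  rw [h3] at h
  linarith

theorem stmt17 {n : ℕ} (hn : 3 ≤ n)
    (φ : Euc n → ℝ) (hφ : ContDiff ℝ (⊤ : ℕ∞) φ) (hcs : HasCompactSupport φ)
    (hsupp : tsupport φ ⊆ {x : Euc n | 0 < ‖x‖ ∧ ‖x‖ < 1}) :
    (((n : ℝ) - 2) / 2) ^ 2 * ∫ x in {x : Euc n | 0 < ‖x‖ ∧ ‖x‖ < 1},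
        φ x ^ 2 / (‖x‖ * (1 - ‖x‖ ^ (n - 2))) ^ 2
      ≤ ∫ x in {x : Euc n | 0 < ‖x‖ ∧ ‖x‖ < 1}, ‖gradient φ x‖ ^ 2 := by
  obtain ⟨m, rfl⟩ : ∃ m, n = m + 2 := ⟨n - 2, by omega⟩
  have hm : m ≠ 0 := by omega
  simp only [Nat.add_sub_cancel]
  have hout : ∀ x ∉ {x : Euc (m + 2) | 0 < ‖x‖ ∧ ‖x‖ < 1}, φ x = 0 := fun x hx ↦
    image_eq_zero_of_notMem_tsupport fun h ↦ hx (hsupp h)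
  have hgrad : ∀ x ∉ tsupport φ, gradient φ x = 0 := fun x hx ↦ by
    simp [gradient, fderiv_of_notMem_tsupport (𝕜 := ℝ) hx]
  rw [setIntegral_eq_integral_of_forall_compl_eq_zero fun x hx ↦ by simp [hout x hx],
    setIntegral_eq_integral_of_forall_compl_eq_zero fun x hx ↦ by
      simp [hgrad x fun h ↦ hx (hsupp h)]]
  have hφ1 : ContDiff ℝ 1 φ := hφ.of_le (by exact_mod_cast le_top)
  have hpos : ∀ x ∈ tsupport φ, 0 < ‖x‖ := fun x hx ↦ (hsupp hx).1
  have hne : ∀ x ∈ tsupport φ, 1 - ‖x‖ ^ m ≠ 0 := fun x hx ↦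
    (sub_pos.mpr (pow_lt_one₀ (norm_nonneg x) (hsupp hx).2 hm)).ne'
  have hN : ∀ x ∈ tsupport φ, ContDiffAt ℝ 1 (fun y : Euc (m + 2) ↦ ‖y‖) x := fun x hx ↦
    contDiffAt_norm ℝ (norm_pos_iff.mp (hpos x hx))
  have hquot {D : Euc (m + 2) → ℝ} : HasCompactSupport fun x ↦ φ x ^ 2 / D x :=
    hcs.mono fun x hx h ↦ hx (by simp [h])
  have hf := contDiff_sq_div_of_tsupport (D := fun x ↦ ‖x‖ ^ 2 - ‖x‖ ^ (m + 2)) hφ1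
    (fun x hx ↦ ((hN x hx).pow 2).sub ((hN x hx).pow (m + 2)))
    fun x hx ↦ by
      rw [show ‖x‖ ^ 2 - ‖x‖ ^ (m + 2) = ‖x‖ ^ 2 * (1 - ‖x‖ ^ m) by ring]
      exact mul_ne_zero (pow_ne_zero 2 (hpos x hx).ne') (hne x hx)
  have hh := contDiff_sq_div_of_tsupport (D := fun x ↦ (‖x‖ * (1 - ‖x‖ ^ m)) ^ 2) hφ1
    (fun x hx ↦ ((hN x hx).mul (contDiffAt_const.sub ((hN x hx).pow m))).pow 2)
    fun x hx ↦ pow_ne_zero 2 (mul_ne_zero (hpos x hx).ne' (hne x hx))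
  have hhi := hh.continuous.integrable_of_hasCompactSupport (μ := volume) hquot
  have hfi := hf.continuous.integrable_of_hasCompactSupport (μ := volume) hquot
  obtain ⟨hei, he⟩ := integral_fderiv_apply_self_s17 hf hquot
  have hgc : Continuous (gradient φ) :=
    (InnerProductSpace.toDual ℝ _).symm.continuous.comp (hφ1.continuous_fderiv one_ne_zero)
  have hgi : Integrable fun x ↦ ‖gradient φ x‖ ^ 2 := by
    refine Continuous.integrable_of_hasCompactSupport (by fun_prop)
      (HasCompactSupport.intro hcs fun x hx ↦ ?_)
    simp [hgrad x hx]
  have hdiv : Integrable fun x ↦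
      fderiv ℝ (fun y ↦ φ y ^ 2 / (‖y‖ ^ 2 - ‖y‖ ^ (m + 2))) x x
        + ((m + 2 : ℕ) : ℝ) * (φ x ^ 2 / (‖x‖ ^ 2 - ‖x‖ ^ (m + 2))) := hei.add (hfi.const_mul ((m + 2 : ℕ) : ℝ))
  rw [← integral_const_mul]
  refine (integral_mono (hhi.const_mul _) (hgi.add (hdiv.const_mul ((m : ℝ) / 2)))
    fun x ↦ ?_).trans_eq ?_
  · by_cases hx : x ∈ tsupport φ
    · have h := hardy_pointwise (gradient φ x) x ((m : ℝ) / 2) (φ x) _ (hpos x hx) (hne x hx)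
      rw [inner_gradient_left] at h
      simp only [Pi.add_apply, fderiv_sq_div_norm_apply_self m
        (hφ1.differentiable one_ne_zero x) (hpos x hx) (hne x hx)]
      push_cast
      rw [add_sub_cancel_right]
      refine h.trans_eq ?_
      ring
    · have h0 := image_eq_zero_of_notMem_tsupport hx
      have hx' : x ∉ tsupport fun x ↦ φ x ^ 2 / (‖x‖ ^ 2 - ‖x‖ ^ (m + 2)) := fun h ↦
        hx (tsupport_sq_div_subset _ _ h)
      simp [h0, hgrad x hx, fderiv_of_notMem_tsupport (𝕜 := ℝ) hx']
  · simp only [Pi.add_apply]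
    rw [integral_add hgi (hdiv.const_mul _), integral_const_mul,
      integral_add hei (hfi.const_mul _), integral_const_mul, he]
    ring
end
end

section
/- Let Ω ⊊ ℝⁿ be a nonempty bounded open convex set and let δ(x) := dist(x, ℝⁿ \ Ω) denote the distance of x ∈ Ω to the complement of Ω. Then the Hardy inequality ∫_Ω |∇φ(x)|² dx ≥ (1/4) ∫_Ω φ(x)²/δ(x)² dx holds for every φ ∈ C_c^∞(Ω). -/
open MeasureTheory

noncomputable section

open Filter Topology

/-- The distance to the complement of a convex open set has a unit supergradient at each point. -/
theorem exists_unit_supergradient_infDist_compl {E : Type*} [NormedAddCommGroup E]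
    [InnerProductSpace ℝ E] [ProperSpace E] {Ω : Set E} (hΩ : IsOpen Ω) (hconv : Convex ℝ Ω)
    (hproper : Ω ≠ Set.univ) {x : E} (hx : x ∈ Ω) :
    ∃ p : E, ‖p‖ = 1 ∧
      ∀ z ∈ Ω, Metric.infDist z Ωᶜ ≤ Metric.infDist x Ωᶜ + inner ℝ p (z - x) := by
  obtain ⟨y, hy, hxy⟩ := hΩ.isClosed_compl.exists_infDist_eq_dist
    (Set.nonempty_compl.2 hproper) x
  obtain ⟨f, hf⟩ := geometric_hahn_banach_open_point hconv hΩ hy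
  set q : E := (InnerProductSpace.toDual ℝ E).symm f with hq_def
  have hfq : ∀ v, f v = inner ℝ q v := fun v => by
    rw [hq_def, InnerProductSpace.toDual_symm_apply]
  have hq : q ≠ 0 := by
    intro h0
    have h1 := hf x hx
    simp [hfq, h0] at h1
  have hq' : 0 < ‖q‖ := norm_pos_iff.2 hq
  set p : E := (-‖q‖⁻¹) • q with hp_def
  have hp : ‖p‖ = 1 := by
    rw [hp_def, norm_smul, norm_neg, norm_inv, norm_norm, inv_mul_cancel₀ hq'.ne']
  have hpos : ∀ z ∈ Ω, 0 < inner ℝ p (z - y) := by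
    intro z hz
    have h1 := hf z hz
    rw [hfq, hfq] at h1
    rw [hp_def, real_inner_smul_left, inner_sub_right]
    have := inv_pos.2 hq'
    nlinarith
  have hle : ∀ z ∈ Ω, Metric.infDist z Ωᶜ ≤ inner ℝ p (z - y) := by
    intro z hz
    have hw : z - inner ℝ p (z - y) • p ∈ Ωᶜ := by
      intro hw
      have h1 := hpos _ hw
      rw [sub_right_comm, inner_sub_right, real_inner_smul_right, real_inner_self_eq_norm_sq,
        hp] at h1
      simp at h1
    refine (Metric.infDist_le_dist_of_mem hw).trans (le_of_eq ?_)
    rw [dist_eq_norm, sub_sub_cancel, norm_smul, hp, mul_one, Real.norm_eq_abs,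
      abs_of_pos (hpos z hz)]
  refine ⟨p, hp, fun z hz => (hle z hz).trans ?_⟩
  have h1 : inner ℝ p (x - y) ≤ Metric.infDist x Ωᶜ := by
    rw [hxy, dist_eq_norm]
    simpa [hp] using real_inner_le_norm p (x - y)
  have h2 : inner ℝ p (z - y) = inner ℝ p (z - x) + inner ℝ p (x - y) := by
    rw [← inner_add_right, sub_add_sub_cancel]
  linarith

theorem sqrt_add_add_sqrt_sub_le {t : ℝ} (ht : |t| ≤ 1) :
    √(1 + t) + √(1 - t) ≤ 2 - t ^ 2 / 4 := by
  obtain ⟨h1, h2⟩ := abs_le.1 ht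
  have ha := Real.sq_sqrt (show 0 ≤ 1 + t by linarith)
  have hb := Real.sq_sqrt (show 0 ≤ 1 - t by linarith)
  have hab : √(1 + t) * √(1 - t) ≤ 1 - t ^ 2 / 2 := by
    rw [← Real.sqrt_mul (by linarith)]
    refine Real.sqrt_le_iff.2 ⟨by nlinarith, by nlinarith [sq_nonneg (t ^ 2)]⟩
  refine abs_le_of_sq_le_sq' ?_ (by nlinarith) |>.2
  nlinarith [sq_nonneg (t ^ 2)]

/-- If `a`, `b` lie below the values at `± s` of an affine function with value `d` at `0`, the
relative second difference of the square root is at most `-s ^ 2 / (4 * d ^ 2)`. -/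
theorem sqrt_div_add_sqrt_div_le {a b d s : ℝ} (hd : 0 < d) (hs : |s| ≤ d)
    (ha : a ≤ d + s) (hb : b ≤ d - s) :
    √a / √d + √b / √d ≤ 2 - s ^ 2 / (4 * d ^ 2) := by
  have ht : |s / d| ≤ 1 := by
    rw [abs_div, abs_of_pos hd]; exact (div_le_one hd).2 hs
  have h1 : √a / √d ≤ √(1 + s / d) := by
    rw [← Real.sqrt_div' _ hd.le]
    refine Real.sqrt_le_sqrt ?_
    rw [div_le_iff₀ hd]
    field_simp
    exact ha
  have h2 : √b / √d ≤ √(1 - s / d) := by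
    rw [← Real.sqrt_div' _ hd.le]
    refine Real.sqrt_le_sqrt ?_
    rw [div_le_iff₀ hd]
    field_simp
    exact hb
  have h3 := sqrt_add_add_sqrt_sub_le ht
  have h4 : (s / d) ^ 2 / 4 = s ^ 2 / (4 * d ^ 2) := by field_simp
  linarith

theorem sub_sq_ge_of_pos {a b u v : ℝ} (hu : 0 < u) (hv : 0 < v) :
    a ^ 2 * (1 - v / u) + b ^ 2 * (1 - u / v) ≤ (b - a) ^ 2 := by
  have key : (b - a) ^ 2 - (a ^ 2 * (1 - v / u) + b ^ 2 * (1 - u / v))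
      = (a * v - b * u) ^ 2 / (u * v) := by
    field_simp
    ring
  have : 0 ≤ (a * v - b * u) ^ 2 / (u * v) := by positivity
  linarith

/-- Discrete ground state inequality: the energy of a difference of `φ` is bounded below by the
relative second difference of a function `u` which is positive near the support of `φ`. -/
theorem integral_mul_second_difference_le {E : Type*} [NormedAddCommGroup E] [MeasurableSpace E]
    [BorelSpace E] [ProperSpace E] (μ : Measure E) [μ.IsAddHaarMeasure]
    {φ u : E → ℝ} (hφ : Continuous φ) (hcs : HasCompactSupport φ) (hu : Continuous u) (v : E)
    (h0 : ∀ x ∈ tsupport φ, 0 < u x) (hp : ∀ x ∈ tsupport φ, 0 < u (x + v))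
    (hm : ∀ x ∈ tsupport φ, 0 < u (x - v)) :
    Integrable (fun x => φ x ^ 2 * (2 - (u (x + v) / u x + u (x - v) / u x))) μ ∧
    Integrable (fun x => (φ (x + v) - φ x) ^ 2) μ ∧
    ∫ x, φ x ^ 2 * (2 - (u (x + v) / u x + u (x - v) / u x)) ∂μ
      ≤ ∫ x, (φ (x + v) - φ x) ^ 2 ∂μ := by
  have hint : ∀ w : E, Integrable (fun x => φ x ^ 2 * (1 - u (x + w) / u x)) μ := by
    intro w
    have hc : ContinuousOn (fun x => φ x ^ 2 * (1 - u (x + w) / u x)) (tsupport φ) := by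
      refine ContinuousOn.mul (by fun_prop) (continuousOn_const.sub ?_)
      exact ContinuousOn.div (by fun_prop) (by fun_prop) fun x hx => (h0 x hx).ne'
    refine (integrableOn_iff_integrable_of_support_subset ?_).1
      (hc.integrableOn_compact hcs)
    intro x hx
    refine subset_tsupport φ fun h => hx ?_
    simp [h]
  have hA := hint v
  have hB : Integrable (fun x => φ x ^ 2 * (1 - u (x - v) / u x)) μ := by
    simpa only [sub_eq_add_neg] using hint (-v)
  have hB' := hB.comp_add_right v
  have hsum : (fun x => φ x ^ 2 * (2 - (u (x + v) / u x + u (x - v) / u x)))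
      = fun x => φ x ^ 2 * (1 - u (x + v) / u x) + φ x ^ 2 * (1 - u (x - v) / u x) := by
    ext x; ring
  have hcs' : HasCompactSupport fun x => φ (x + v) :=
    hcs.comp_homeomorph (Homeomorph.addRight v)
  have hD : Integrable (fun x => (φ (x + v) - φ x) ^ 2) μ := by
    refine Continuous.integrable_of_hasCompactSupport (by fun_prop) ?_
    exact (hcs'.sub hcs).comp_left (g := fun t : ℝ => t ^ 2) (by simp)
  refine ⟨hsum ▸ hA.add hB, hD, ?_⟩
  rw [hsum, integral_add hA hB,
    ← integral_add_right_eq_self (μ := μ) (fun x => φ x ^ 2 * (1 - u (x - v) / u x)) v,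
    ← integral_add hA hB']
  refine integral_mono (hA.add hB') hD fun x => ?_
  simp only [add_sub_cancel_right]
  by_cases hx : x ∈ tsupport φ
  · exact sub_sq_ge_of_pos (h0 x hx) (hp x hx)
  by_cases hx' : x + v ∈ tsupport φ
  · have := hm _ hx'
    rw [add_sub_cancel_right] at this
    exact sub_sq_ge_of_pos this (h0 _ hx')
  simp [image_eq_zero_of_notMem_tsupport hx, image_eq_zero_of_notMem_tsupport hx']

theorem tendsto_integral_sum_difference_quotient_sq {n : ℕ} {φ : Euc n → ℝ}
    (hφ : ContDiff ℝ 1 φ) (hcs : HasCompactSupport φ) :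
    Tendsto (fun h : ℝ => ∫ x, ∑ i, ((φ (x + h • EuclideanSpace.single i 1) - φ x) / h) ^ 2)
      (𝓝[>] 0) (𝓝 (∫ x, ‖gradient φ x‖ ^ 2)) := by
  obtain ⟨C, hC⟩ := hφ.lipschitzWith_of_hasCompactSupport hcs one_ne_zero
  set K := Metric.cthickening 1 (tsupport φ) with hK_def
  have hK : IsCompact K := hcs.isCompact.cthickening
  have hsmall : ∀ᶠ h : ℝ in 𝓝[>] 0, 0 < h ∧ h ≤ 1 :=
    (eventually_mem_nhdsWithin).and
      (nhdsWithin_le_nhds (eventually_le_nhds (show (0 : ℝ) < 1 by norm_num)))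
  refine tendsto_integral_filter_of_dominated_convergence
    (K.indicator fun _ => ∑ _i : Fin n, (C : ℝ) ^ 2) ?_ ?_ ?_ ?_
  · refine Eventually.of_forall fun h => Continuous.aestronglyMeasurable ?_
    have := hφ.continuous
    fun_prop
  · filter_upwards [hsmall] with h hh
    refine ae_of_all _ fun x => ?_
    have hnorm : ∀ i : Fin n, ‖h • (EuclideanSpace.single i 1 : Euc n)‖ = h := fun i => by
      rw [norm_smul, Real.norm_eq_abs, abs_of_pos hh.1]; simp
    rw [Real.norm_of_nonneg (Finset.sum_nonneg fun i _ => sq_nonneg _)]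
    by_cases hx : x ∈ K
    · rw [Set.indicator_of_mem hx]
      refine Finset.sum_le_sum fun i _ => ?_
      refine sq_le_sq' ?_ ?_ <;>
      · have h1 := hC.dist_le_mul (x + h • EuclideanSpace.single i 1) x
        rw [dist_eq_norm, dist_eq_norm, add_sub_cancel_left, hnorm, Real.norm_eq_abs,
          abs_le] at h1
        first
        | (rw [div_le_iff₀ hh.1]; exact h1.2)
        | (rw [le_div_iff₀ hh.1]; linarith [h1.1])
    · rw [Set.indicator_of_notMem hx]
      refine (Finset.sum_eq_zero fun i _ => ?_).le
      have h1 : x ∉ tsupport φ := fun h => hx (Metric.self_subset_cthickening _ h)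
      have h2 : x + h • EuclideanSpace.single i 1 ∉ tsupport φ := fun h' => hx <| by
        refine Metric.mem_cthickening_of_dist_le x _ 1 _ h' ?_
        rw [dist_eq_norm, sub_add_cancel_left, norm_neg, hnorm]
        exact hh.2
      simp [image_eq_zero_of_notMem_tsupport h1, image_eq_zero_of_notMem_tsupport h2]
  · exact (integrable_indicator_iff hK.measurableSet).2
      (integrableOn_const hK.measure_lt_top.ne)
  · refine ae_of_all _ fun x => ?_
    have hd : DifferentiableAt ℝ φ x := hφ.differentiable one_ne_zero x
    have hg : ‖gradient φ x‖ ^ 2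
        = ∑ i, (fderiv ℝ φ x (EuclideanSpace.single i 1)) ^ 2 := by
      rw [EuclideanSpace.real_norm_sq_eq]
      refine Finset.sum_congr rfl fun i _ => ?_
      rw [← InnerProductSpace.toDual_symm_apply, EuclideanSpace.inner_single_right]
      simp [gradient]
    rw [hg]
    refine tendsto_finsetSum _ fun i _ => Tendsto.pow ?_ 2
    have hl := (hd.hasFDerivAt.hasLineDerivAt (EuclideanSpace.single i 1)).tendsto_slope_zero_right
    refine hl.congr fun t => ?_
    simp [smul_eq_mul, div_eq_inv_mul]

theorem stmt18 {n : ℕ} (hn : 1 ≤ n) {Ω : Set (Euc n)}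
    (hne : Ω.Nonempty) (hΩ : IsOpen Ω) (hconv : Convex ℝ Ω)
    (hbdd : Bornology.IsBounded Ω) (hproper : Ω ≠ Set.univ)
    (φ : Euc n → ℝ) (hφ : ContDiff ℝ (⊤ : ℕ∞) φ) (hcs : HasCompactSupport φ)
    (hsupp : tsupport φ ⊆ Ω) :
    (1 / 4 : ℝ) * ∫ x in Ω, φ x ^ 2 / Metric.infDist x Ωᶜ ^ 2
      ≤ ∫ x in Ω, ‖gradient φ x‖ ^ 2 := by
  have hzero : ∀ x, x ∉ Ω → φ x = 0 := fun x hx =>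
    image_eq_zero_of_notMem_tsupport fun h => hx (hsupp h)
  rw [setIntegral_eq_integral_of_forall_compl_eq_zero fun x hx => by simp [hzero x hx],
    setIntegral_eq_integral_of_forall_compl_eq_zero fun x hx => by
      have : fderiv ℝ φ x = 0 := image_eq_zero_of_notMem_tsupport fun h =>
        hx (hsupp (tsupport_fderiv_subset ℝ h))
      simp [gradient, this]]
  have hφ1 : ContDiff ℝ 1 φ := hφ.of_le (by exact_mod_cast le_top)
  refine ge_of_tendsto (tendsto_integral_sum_difference_quotient_sq hφ1 hcs) ?_
  have hcompl : (Ωᶜ).Nonempty := Set.nonempty_compl.2 hproper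
  have hdpos : ∀ x ∈ Ω, 0 < Metric.infDist x Ωᶜ := fun x hx =>
    (hΩ.isClosed_compl.notMem_iff_infDist_pos hcompl).1 (by simpa using hx)
  have hdcont : Continuous fun x : Euc n => Metric.infDist x Ωᶜ := Metric.continuous_infDist_pt _
  obtain ⟨ε, hε, hεd⟩ : ∃ ε > 0, ∀ x ∈ tsupport φ, ε ≤ Metric.infDist x Ωᶜ :=
    hcs.isCompact.exists_forall_le' hdcont.continuousOn fun x hx => hdpos x (hsupp hx)
  filter_upwards [eventually_mem_nhdsWithin, nhdsWithin_le_nhds (eventually_lt_nhds hε)]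
    with h hh hhε
  replace hh : 0 < h := hh
  set e : Fin n → Euc n := fun i => h • EuclideanSpace.single i 1 with he
  have hnorm : ∀ i, ‖e i‖ = h := fun i => by
    rw [he, norm_smul, Real.norm_eq_abs, abs_of_pos hh]; simp
  have hmem : ∀ x ∈ tsupport φ, ∀ w : Euc n, ‖w‖ = h → x + w ∈ Ω := by
    intro x hx w hw
    by_contra hcon
    have h1 := Metric.infDist_le_dist_of_mem (x := x) (show x + w ∈ Ωᶜ from hcon)
    rw [dist_eq_norm, sub_add_cancel_left, norm_neg, hw] at h1
    linarith [hεd x hx]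
  have hmem' : ∀ x ∈ tsupport φ, ∀ i, x - e i ∈ Ω := fun x hx i => by
    rw [sub_eq_add_neg]; exact hmem x hx _ (by rw [norm_neg, hnorm])
  set u : Euc n → ℝ := fun x => √(Metric.infDist x Ωᶜ) with hu_def
  have hupos : ∀ x ∈ Ω, 0 < u x := fun x hx => Real.sqrt_pos.2 (hdpos x hx)
  have key := fun i => integral_mul_second_difference_le (volume : Measure (Euc n))
    hφ.continuous hcs (u := u) hdcont.sqrt (e i) (fun x hx => hupos x (hsupp hx))
    (fun x hx => hupos _ (hmem x hx _ (hnorm i))) (fun x hx => hupos _ (hmem' x hx i))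
  have hL : ∫ x, h ^ 2 * (φ x ^ 2 / (4 * Metric.infDist x Ωᶜ ^ 2))
      ≤ ∫ x, ∑ i, φ x ^ 2 * (2 - (u (x + e i) / u x + u (x - e i) / u x)) := by
    refine integral_mono_of_nonneg (ae_of_all _ fun x => by positivity)
      (integrable_finsetSum _ fun i _ => (key i).1) (ae_of_all _ fun x => ?_)
    by_cases hx : x ∈ tsupport φ
    swap
    · simp [image_eq_zero_of_notMem_tsupport hx]
    obtain ⟨p, hp, hpd⟩ :=
      exists_unit_supergradient_infDist_compl hΩ hconv hproper (hsupp hx)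
    have hd := hdpos x (hsupp hx)
    have hpe : ∀ i, inner ℝ p (e i) = h * p i := fun i => by
      rw [he, real_inner_smul_right, EuclideanSpace.inner_single_right]; simp
    have hi : ∀ i, (h * p i) ^ 2 / (4 * Metric.infDist x Ωᶜ ^ 2)
        ≤ 2 - (u (x + e i) / u x + u (x - e i) / u x) := by
      intro i
      have h1 := hpd _ (hmem x hx _ (hnorm i))
      have h2 := hpd _ (hmem' x hx i)
      rw [add_sub_cancel_left, hpe] at h1
      rw [sub_sub_cancel_left, inner_neg_right, hpe, ← sub_eq_add_neg] at h2
      have hs : |h * p i| ≤ Metric.infDist x Ωᶜ := by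
        rw [← hpe]
        refine (abs_real_inner_le_norm p (e i)).trans ?_
        rw [hp, hnorm, one_mul]
        linarith [hεd x hx]
      have := sqrt_div_add_sqrt_div_le hd hs h1 h2
      simp only [hu_def]
      linarith
    have hsum : ∑ i, p i ^ 2 = 1 := by
      rw [← EuclideanSpace.real_norm_sq_eq, hp, one_pow]
    calc h ^ 2 * (φ x ^ 2 / (4 * Metric.infDist x Ωᶜ ^ 2))
        = (φ x ^ 2 * h ^ 2 / (4 * Metric.infDist x Ωᶜ ^ 2)) * ∑ i, p i ^ 2 := by
          rw [hsum]; ring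
      _ = ∑ i, φ x ^ 2 * ((h * p i) ^ 2 / (4 * Metric.infDist x Ωᶜ ^ 2)) := by
          rw [Finset.mul_sum]; exact Finset.sum_congr rfl fun i _ => by ring
      _ ≤ _ := Finset.sum_le_sum fun i _ => mul_le_mul_of_nonneg_left (hi i) (sq_nonneg _)
  have hR : ∫ x, ∑ i, φ x ^ 2 * (2 - (u (x + e i) / u x + u (x - e i) / u x))
      ≤ ∫ x, ∑ i, (φ (x + e i) - φ x) ^ 2 := by
    rw [integral_finsetSum _ fun i _ => (key i).1, integral_finsetSum _ fun i _ => (key i).2.1]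
    exact Finset.sum_le_sum fun i _ => (key i).2.2
  have hscale : ∫ x, ∑ i, ((φ (x + e i) - φ x) / h) ^ 2
      = (h ^ 2)⁻¹ * ∫ x, ∑ i, (φ (x + e i) - φ x) ^ 2 := by
    rw [← integral_const_mul]
    refine integral_congr_ae (ae_of_all _ fun x => ?_)
    simp only [Finset.mul_sum, div_eq_inv_mul, mul_pow, inv_pow]
  have hquarter : (1 / 4 : ℝ) * ∫ x, φ x ^ 2 / Metric.infDist x Ωᶜ ^ 2
      = (h ^ 2)⁻¹ * ∫ x, h ^ 2 * (φ x ^ 2 / (4 * Metric.infDist x Ωᶜ ^ 2)) := by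
    rw [integral_const_mul, inv_mul_cancel_left₀ (by positivity), ← integral_const_mul]
    refine integral_congr_ae (ae_of_all _ fun x => ?_)
    simp only [div_eq_mul_inv, mul_inv]
    ring
  rw [hquarter, hscale]
  exact mul_le_mul_of_nonneg_left (hL.trans hR) (by positivity)
end
end

section
/- Let n ≥ 2, let V : (0,∞) → ℝ be continuous, and let ψ : (0,∞) → ℝ be a twice continuously differentiable positive function satisfying the radial equation −(t^{n−1}ψ'(t))' + t^{n−1}V(t)ψ(t) = 0 for all t > 0, such that ψ extends continuously to t = 0 with ψ(0) > 0 and ∫_1^∞ r^{1−n} ψ(r)^{−2} dr < ∞. Define g₀(t) := ψ(t) ∫_t^∞ r^{1−n} ψ(r)^{−2} dr, G₀(t) := √(ψ(t) g₀(t)), and W(t) := t^{2−2n}/(4 (ψ(t) g₀(t))²). Then G₀ satisfies −(t^{n−1}G₀'(t))' + t^{n−1}(V(t)−W(t))G₀(t) = 0 for all t > 0. -/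
open MeasureTheory

noncomputable section

theorem hasDerivAt_setIntegral_Ioi {f : ℝ → ℝ} (hf : ContinuousOn f (Set.Ioi 0))
    (hi : ∀ t : ℝ, 0 < t → IntegrableOn f (Set.Ioi t)) {t : ℝ} (ht : 0 < t) :
    HasDerivAt (fun s => ∫ r in Set.Ioi s, f r) (-f t) t := by
  have hi' : IntervalIntegrable f volume (t / 2) t :=
    (intervalIntegrable_iff_integrableOn_Ioc_of_le (by linarith)).2
      ((hi (t / 2) (by linarith)).mono_set Set.Ioc_subset_Ioi_self)
  have h1 : HasDerivAt (fun s => ∫ r in (t / 2)..s, f r) (f t) t :=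
    intervalIntegral.integral_hasDerivAt_right hi'
      (hf.stronglyMeasurableAtFilter isOpen_Ioi t ht)
      (hf.continuousAt (Ioi_mem_nhds ht))
  have h2 := h1.const_sub (∫ r in Set.Ioi (t / 2), f r)
  refine h2.congr_of_eventuallyEq ?_
  filter_upwards [Ioi_mem_nhds ht] with s hs
  rw [← intervalIntegral.integral_interval_add_Ioi (hi (t / 2) (by linarith)) (hi s hs)]
  ring

theorem integrableOn_Ioi_of_continuousOn {f : ℝ → ℝ} (hf : ContinuousOn f (Set.Ioi 0))
    {a : ℝ} (hi : IntegrableOn f (Set.Ioi a)) {t : ℝ} (ht : 0 < t) :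
    IntegrableOn f (Set.Ioi t) := by
  have h1 : IntegrableOn f (Set.Icc t a) :=
    (hf.mono fun x hx => lt_of_lt_of_le ht hx.1).integrableOn_Icc
  refine (h1.union hi).mono_set fun x hx => ?_
  rcases le_or_gt x a with h | h
  · exact Or.inl ⟨le_of_lt hx, h⟩
  · exact Or.inr h

theorem setIntegral_Ioi_pos {f : ℝ → ℝ} {t : ℝ} (hi : IntegrableOn f (Set.Ioi t))
    (hpos : ∀ r, t < r → 0 < f r) : 0 < ∫ r in Set.Ioi t, f r := by
  rw [setIntegral_pos_iff_support_of_nonneg_ae _ hi]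
  · have : Function.support f ∩ Set.Ioi t = Set.Ioi t :=
      Set.inter_eq_right.2 fun r hr => (hpos r hr).ne'
    simp [this]
  · exact (ae_restrict_iff' measurableSet_Ioi).2 (Filter.Eventually.of_forall
      fun r hr => (hpos r hr).le)

theorem stmt19 {n : ℕ} (hn : 2 ≤ n) (V ψ : ℝ → ℝ)
    (hV : ContinuousOn V (Set.Ioi (0 : ℝ)))
    (hψ : ContDiffOn ℝ 2 ψ (Set.Ioi (0 : ℝ)))
    (hψpos : ∀ t : ℝ, 0 < t → 0 < ψ t)
    (hψeq : ∀ t : ℝ, 0 < t →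
      -(deriv (fun s : ℝ => s ^ (n - 1) * deriv ψ s) t)
        + t ^ (n - 1) * V t * ψ t = 0)
    (hext : Filter.Tendsto ψ (nhdsWithin 0 (Set.Ioi (0 : ℝ))) (nhds (ψ 0)))
    (hψ0 : 0 < ψ 0)
    (hint : IntegrableOn (fun r : ℝ => r ^ (1 - (n : ℝ)) * (ψ r ^ 2)⁻¹)
      (Set.Ioi (1 : ℝ)))
    (g₀ G₀ W : ℝ → ℝ)
    (hg₀ : ∀ t : ℝ, g₀ t =
      ψ t * ∫ r in Set.Ioi t, r ^ (1 - (n : ℝ)) * (ψ r ^ 2)⁻¹)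
    (hG₀ : ∀ t : ℝ, G₀ t = Real.sqrt (ψ t * g₀ t))
    (hW : ∀ t : ℝ, W t = t ^ (2 - 2 * (n : ℝ)) / (4 * (ψ t * g₀ t) ^ 2)) :
    ∀ t : ℝ, 0 < t →
      -(deriv (fun s : ℝ => s ^ (n - 1) * deriv G₀ s) t)
        + t ^ (n - 1) * (V t - W t) * G₀ t = 0 := by
  set f : ℝ → ℝ := fun r => r ^ (1 - (n : ℝ)) * (ψ r ^ 2)⁻¹ with hf
  set I : ℝ → ℝ := fun t => ∫ r in Set.Ioi t, f r with hI
  have hpow : ∀ t : ℝ, 0 < t → t ^ (1 - (n : ℝ)) = (t ^ (n - 1))⁻¹ := fun t ht => by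
    rw [← Real.rpow_natCast, ← Real.rpow_neg ht.le, Nat.cast_sub (by omega)]
    congr 1
    push_cast
    ring
  have hpow2 : ∀ t : ℝ, 0 < t → t ^ (2 - 2 * (n : ℝ)) = ((t ^ (n - 1))⁻¹) ^ 2 := fun t ht => by
    rw [← hpow t ht, ← Real.rpow_natCast, ← Real.rpow_mul ht.le]
    congr 1
    push_cast
    ring
  have hcont : ContinuousOn f (Set.Ioi 0) :=
    (continuousOn_id.rpow_const fun x hx => Or.inl (ne_of_gt hx)).mul
      ((hψ.continuousOn.pow 2).inv₀ fun x hx => (pow_pos (hψpos x hx) 2).ne')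
  have hint' : ∀ t : ℝ, 0 < t → IntegrableOn f (Set.Ioi t) := fun t ht =>
    integrableOn_Ioi_of_continuousOn hcont hint ht
  have hIpos : ∀ t : ℝ, 0 < t → 0 < I t := fun t ht =>
    setIntegral_Ioi_pos (hint' t ht) fun r hr =>
      mul_pos (Real.rpow_pos_of_pos (ht.trans hr) _) (inv_pos.2 (pow_pos (hψpos r (ht.trans hr)) 2))
  have hIderiv : ∀ t : ℝ, 0 < t → HasDerivAt I (-((t ^ (n - 1))⁻¹ * (ψ t ^ 2)⁻¹)) t :=
    fun t ht => by
      rw [← hpow t ht]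
      exact hasDerivAt_setIntegral_Ioi hcont hint' ht
  have hψd : ∀ t : ℝ, 0 < t → HasDerivAt ψ (deriv ψ t) t := fun t ht =>
    ((hψ.differentiableOn (by norm_num)).differentiableAt (Ioi_mem_nhds ht)).hasDerivAt
  have hψdd : ∀ t : ℝ, 0 < t → DifferentiableAt ℝ (deriv ψ) t := fun t ht =>
    (((contDiffOn_succ_iff_deriv_of_isOpen (n := 1) isOpen_Ioi).1 hψ).2.2.differentiableOn
      (by norm_num)).differentiableAt (Ioi_mem_nhds ht)
  have hp : ∀ t : ℝ, 0 < t →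
      HasDerivAt (fun s => s ^ (n - 1) * deriv ψ s) (t ^ (n - 1) * V t * ψ t) t := fun t ht => by
    have h : DifferentiableAt ℝ (fun s : ℝ => s ^ (n - 1) * deriv ψ s) t :=
      (differentiableAt_id.pow _).mul (hψdd t ht)
    rw [show t ^ (n - 1) * V t * ψ t = deriv (fun s : ℝ => s ^ (n - 1) * deriv ψ s) t by
      linarith [hψeq t ht]]
    exact h.hasDerivAt
  have hG : ∀ t : ℝ, 0 < t → G₀ t = ψ t * √(I t) := fun t ht => by
    rw [hG₀, hg₀, ← mul_assoc, Real.sqrt_mul (mul_self_nonneg _),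
      Real.sqrt_mul_self (hψpos t ht).le]
  have hS : ∀ t : ℝ, 0 < t → HasDerivAt (fun s => √(I s))
      (-((t ^ (n - 1))⁻¹ * (ψ t ^ 2)⁻¹) / (2 * √(I t))) t := fun t ht =>
    (hIderiv t ht).sqrt (hIpos t ht).ne'
  have hGd : ∀ t : ℝ, 0 < t → t ^ (n - 1) * deriv G₀ t =
      t ^ (n - 1) * deriv ψ t * √(I t) - (2 * (ψ t * √(I t)))⁻¹ := fun t ht => by
    have h : HasDerivAt G₀ _ t := ((hψd t ht).mul (hS t ht)).congr_of_eventuallyEq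
      (Filter.eventuallyEq_of_mem (Ioi_mem_nhds ht) hG)
    have h1 := hψpos t ht
    have h2 := Real.sqrt_pos.2 (hIpos t ht)
    have h3 := pow_pos ht (n - 1)
    rw [h.deriv]
    field_simp
    ring
  intro t ht
  have h1 := hψpos t ht
  have h2 := Real.sqrt_pos.2 (hIpos t ht)
  have h3 := pow_pos ht (n - 1)
  have h4 := Real.sq_sqrt (hIpos t ht).le
  have hD := (((hp t ht).mul (hS t ht)).sub
    ((((hψd t ht).mul (hS t ht)).const_mul 2).inv
      (mul_pos two_pos (mul_pos h1 h2)).ne')).congr_of_eventuallyEq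
      (Filter.eventuallyEq_of_mem (Ioi_mem_nhds ht) hGd)
  have hWt : W t = ((t ^ (n - 1))⁻¹) ^ 2 / (4 * (ψ t * (ψ t * √(I t) ^ 2)) ^ 2) := by
    rw [hW, hg₀, hpow2 t ht, h4]
  rw [hD.deriv, hWt, hG t ht]
  simp only [Pi.mul_apply]
  field_simp
  ring
end
end
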